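/- A function G : {0,1}* → ℤ is partial A′-recursive if and only if there exist total A-recursive functions f, g : {0,1}* × ℕ → ℕ such that for all p, G(p) = max{f(p,t) : t ∈ ℕ} − max{g(p,t) : t ∈ ℕ}, where G(p) is defined exactly when both maxima are finite. -/

import Mathlib

/-- Codes for oracle partial recursive functions: `Nat.Partrec.Code` with an
extra constructor for one call to the oracle. -/
inductive OCode : Type
  | zero | succ | left | right | oracle
  | pair : OCode → OCode → OCode
  | comp : OCode → OCode → OCode
  | prec : OCode → OCode → OCode
  | rfind' : OCode → OCode

/-- Evaluation of an oracle code, relative to the oracle `O`. -/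
def evalo (O : ℕ →. ℕ) : OCode → ℕ →. ℕ
  | .zero => fun _ => Part.some 0
  | .succ => fun n => Part.some (n + 1)
  | .left => fun n => Part.some (Nat.unpair n).1
  | .right => fun n => Part.some (Nat.unpair n).2
  | .oracle => O
  | .pair cf cg => fun n => Nat.pair <$> evalo O cf n <*> evalo O cg n
  | .comp cf cg => fun n => evalo O cg n >>= evalo O cf
  | .prec cf cg => Nat.unpaired fun a n =>
      n.rec (evalo O cf a) fun y IH => do
        let i ← IH
        evalo O cg (Nat.pair a (Nat.pair y i))
  | .rfind' cf => Nat.unpaired fun a m =>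
      (Nat.rfind fun n => (fun x => x = 0) <$> evalo O cf (Nat.pair a (n + m))).map (· + m)

open Classical in
/-- The characteristic (total) partial function of a set of naturals. -/
noncomputable def chi (A : Set ℕ) : ℕ →. ℕ :=
  fun n => Part.some (if n ∈ A then 1 else 0)

/-- `f` is partial `A`-recursive (via encodings of `α` and `β`). -/
def RecInP {α β : Type*} [Primcodable α] [Primcodable β] (A : Set ℕ) (f : α →. β) : Prop :=
  ∃ c : OCode, ∀ a : α,
    evalo (chi A) c (Encodable.encode a) = (f a).map Encodable.encode

/-- An injective encoding of oracle codes into ℕ. -/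
def encOCode : OCode → ℕ
  | .zero => 0
  | .succ => 1
  | .left => 2
  | .right => 3
  | .oracle => 4
  | .pair a b => 4 * Nat.pair (encOCode a) (encOCode b) + 5
  | .comp a b => 4 * Nat.pair (encOCode a) (encOCode b) + 6
  | .prec a b => 4 * Nat.pair (encOCode a) (encOCode b) + 7
  | .rfind' a => 4 * encOCode a + 8

/-- The Turing jump A′ of A : the self-halting set relative to A. -/
def jump (A : Set ℕ) : Set ℕ :=
  {n | ∃ c : OCode, encOCode c = n ∧ (evalo (chi A) c n).Dom}

/-- The acceptable enumeration of A-r.e. subsets of ℕ: `W A e` is the domain of the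
A-partial recursive function coded by `e`. -/
def W (A : Set ℕ) (e : ℕ) : Set ℕ :=
  {n | ∃ c : OCode, encOCode c = e ∧ (evalo (chi A) c n).Dom}

/-- The max of a set of naturals, as a partial value. -/
noncomputable def pmax (S : Set ℕ) : Part ℕ := ⟨S.Nonempty ∧ BddAbove S, fun _ => sSup S⟩

/-- Difference of two partial naturals, as a partial integer;
defined exactly when both are. -/
def psub (a b : Part ℕ) : Part ℤ := do
  let x ← a
  let y ← b
  pure ((x : ℤ) - (y : ℤ))

theorem encOCode_injective : Function.Injective encOCode := by
  intro c
  induction c with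
  | pair a b iha ihb | comp a b iha ihb | prec a b iha ihb =>
    intro d h
    cases d <;> simp only [encOCode] at h <;> try omega
    rename_i a' b'
    obtain ⟨h₁, h₂⟩ := Nat.pair_eq_pair.1
      (by omega : Nat.pair (encOCode a) (encOCode b) = Nat.pair (encOCode a') (encOCode b'))
    rw [iha h₁, ihb h₂]
  | rfind' a iha =>
    intro d h
    cases d <;> simp only [encOCode] at h <;> try omega
    rename_i a'
    rw [iha (by omega : encOCode a = encOCode a')]
  | _ =>
    intro d h
    cases d <;> simp only [encOCode] at h <;> first | rfl | omega

theorem encOCode_surjective : Function.Surjective encOCode := by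
  intro e
  induction e using Nat.strong_induction_on with
  | _ e ih =>
    by_cases h0 : e < 5
    · interval_cases e
      exacts [⟨.zero, rfl⟩, ⟨.succ, rfl⟩, ⟨.left, rfl⟩, ⟨.right, rfl⟩, ⟨.oracle, rfl⟩]
    · set k := (e - 5) / 4 with hk
      have hlt : k < e := by omega
      obtain ⟨a, ha⟩ := ih k.unpair.1 ((Nat.unpair_left_le k).trans_lt hlt)
      obtain ⟨b, hb⟩ := ih k.unpair.2 ((Nat.unpair_right_le k).trans_lt hlt)
      obtain ⟨c, hc⟩ := ih k hlt
      have h4 : (e - 5) % 4 < 4 := Nat.mod_lt _ (by norm_num)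
      have hp : Nat.pair (encOCode a) (encOCode b) = k := by rw [ha, hb, Nat.pair_unpair]
      interval_cases h : (e - 5) % 4
      · exact ⟨.pair a b, by simp only [encOCode, hp]; omega⟩
      · exact ⟨.comp a b, by simp only [encOCode, hp]; omega⟩
      · exact ⟨.prec a b, by simp only [encOCode, hp]; omega⟩
      · exact ⟨.rfind' c, by simp only [encOCode, hc]; omega⟩

/-- `f : ℕ →. ℕ` is computed by some oracle code with oracle `O`. -/
def HasOCode (O f : ℕ →. ℕ) : Prop := ∃ c : OCode, evalo O c = f

namespace HasOCode

variable {O f g : ℕ →. ℕ}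

theorem pair (hf : HasOCode O f) (hg : HasOCode O g) :
    HasOCode O fun n => Nat.pair <$> f n <*> g n := by
  obtain ⟨c, rfl⟩ := hf
  obtain ⟨d, rfl⟩ := hg
  exact ⟨.pair c d, rfl⟩

theorem comp (hf : HasOCode O f) (hg : HasOCode O g) :
    HasOCode O fun n => g n >>= f := by
  obtain ⟨c, rfl⟩ := hf
  obtain ⟨d, rfl⟩ := hg
  exact ⟨.comp c d, rfl⟩

theorem prec (hf : HasOCode O f) (hg : HasOCode O g) :
    HasOCode O (Nat.unpaired fun a n =>
      n.rec (f a) fun y IH => do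
        let i ← IH
        g (Nat.pair a (Nat.pair y i))) := by
  obtain ⟨c, rfl⟩ := hf
  obtain ⟨d, rfl⟩ := hg
  exact ⟨.prec c d, rfl⟩

theorem rfind (hf : HasOCode O f) :
    HasOCode O fun a => Nat.rfind fun n => (fun m => m = 0) <$> f (Nat.pair a n) := by
  obtain ⟨c, rfl⟩ := hf
  refine ⟨.comp (.rfind' c) (.pair (.pair .left .right) .zero), ?_⟩
  simp [evalo, Seq.seq, Part.map_id']
  rfl

theorem of_partrec (hf : Nat.Partrec f) : HasOCode O f := by
  induction hf with
  | zero => exact ⟨.zero, rfl⟩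
  | succ => exact ⟨.succ, rfl⟩
  | left => exact ⟨.left, rfl⟩
  | right => exact ⟨.right, rfl⟩
  | pair _ _ hf hg => exact hf.pair hg
  | comp _ _ hf hg => exact hf.comp hg
  | prec _ _ hf hg => exact hf.prec hg
  | rfind _ hf => exact hf.rfind

theorem of_primrec {f : ℕ → ℕ} (hf : Primrec f) : HasOCode O fun n => Part.some (f n) :=
  of_partrec (Nat.Partrec.of_primrec (Primrec.nat_iff.1 hf))

theorem oracle : HasOCode O O := ⟨.oracle, rfl⟩

theorem of_eq (hf : HasOCode O f) (h : ∀ n, f n = g n) : HasOCode O g :=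
  (funext h : f = g) ▸ hf

theorem comp_primrec {h : ℕ → ℕ} (hf : HasOCode O f) (hh : Primrec h) :
    HasOCode O fun n => f (h n) := by
  exact (hf.comp (of_primrec hh)).of_eq fun n => Part.bind_some (h n) f

theorem map_primrec {h : ℕ → ℕ} (hh : Primrec h) (hf : HasOCode O f) :
    HasOCode O fun n => (f n).map h := by
  have := (of_primrec (O := O) hh).comp hf
  simpa [Part.bind_some_eq_map] using this

theorem map₂_primrec {h : ℕ → ℕ → ℕ} (hh : Primrec₂ h) (hf : HasOCode O f)
    (hg : HasOCode O g) : HasOCode O fun n => (f n).bind fun a => (g n).map (h a) := by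
  have := (hf.pair hg).map_primrec
    (hh.comp (Primrec.fst.comp Primrec.unpair) (Primrec.snd.comp Primrec.unpair))
  have e : ∀ n, ((Nat.pair <$> f n <*> g n).map fun z => h z.unpair.1 z.unpair.2) =
      (f n).bind fun a => (g n).map (h a) := by
    intro n
    ext y
    simp [Seq.seq, Part.mem_map_iff, Part.mem_bind_iff]
  exact this.of_eq e

end HasOCode

/-- The code of a constant function. -/
def constOCode : ℕ → OCode
  | 0 => .zero
  | n + 1 => .comp .succ (constOCode n)

theorem evalo_constOCode (O : ℕ →. ℕ) (k n : ℕ) : evalo O (constOCode k) n = Part.some k := by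
  induction k with
  | zero => rfl
  | succ k ih => simp [constOCode, evalo, ih]

theorem primrec_encOCode_constOCode : Primrec fun n => encOCode (constOCode n) := by
  have h : Primrec₂ fun (_ y : ℕ) => 4 * Nat.pair 1 y + 6 :=
    (Primrec.nat_add.comp (Primrec.nat_mul.comp (Primrec.const 4)
      (Primrec₂.natPair.comp (Primrec.const 1) Primrec.snd)) (Primrec.const 6)).to₂
  refine (Primrec.nat_rec₁ 0 h).of_eq fun n => ?_
  induction n with
  | zero => rfl
  | succ n ih => simp only [constOCode, encOCode, ← ih]

theorem encode_sub_eq (x y : ℕ) :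
    Encodable.encode ((x : ℤ) - y) = if y ≤ x then 2 * (x - y) else 2 * (y - x - 1) + 1 := by
  split_ifs with h
  · obtain ⟨k, rfl⟩ := Nat.exists_eq_add_of_le h
    have : ((y + k : ℕ) : ℤ) - y = Int.ofNat k := by simp
    rw [this, Nat.add_sub_cancel_left]
    rfl
  · obtain ⟨k, rfl⟩ := Nat.exists_eq_add_of_lt (not_le.1 h)
    have : (x : ℤ) - ((x + k + 1 : ℕ) : ℤ) = Int.negSucc k := by
      simp [Int.negSucc_eq]; ring
    rw [this, show x + k + 1 - x - 1 = k by omega]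
    rfl

theorem primrec_encode_sub : Primrec₂ fun x y : ℕ => Encodable.encode ((x : ℤ) - y) := by
  have h : Primrec₂ fun x y : ℕ => if y ≤ x then 2 * (x - y) else 2 * (y - x - 1) + 1 :=
    Primrec.ite (Primrec.nat_le.comp Primrec.snd Primrec.fst)
      (Primrec.nat_double.comp (Primrec.nat_sub.comp Primrec.fst Primrec.snd))
      (Primrec.nat_double_succ.comp (Primrec.nat_sub.comp
        (Primrec.nat_sub.comp Primrec.snd Primrec.fst) (Primrec.const 1)))
  exact h.of_eq fun x y => (encode_sub_eq x y).symm

theorem encOCode_mem_jump {A : Set ℕ} {c : OCode} :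
    encOCode c ∈ jump A ↔ (evalo (chi A) c (encOCode c)).Dom :=
  ⟨fun ⟨_, h, hd⟩ => encOCode_injective h ▸ hd, fun h => ⟨c, rfl, h⟩⟩

/-- The domain of an `A`-computable function is many-one reducible to the jump of `A`. -/
theorem HasOCode.exists_primrec_mem_jump {A : Set ℕ} {f : ℕ →. ℕ} (hf : HasOCode (chi A) f) :
    ∃ s : ℕ → ℕ, Primrec s ∧ ∀ n, s n ∈ jump A ↔ (f n).Dom := by
  obtain ⟨c, rfl⟩ := hf
  refine ⟨fun n => encOCode (.comp c (constOCode n)), ?_, fun n => ?_⟩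
  · exact Primrec.nat_add.comp (Primrec.nat_mul.comp (Primrec.const 4)
      (Primrec₂.natPair.comp (Primrec.const _) primrec_encOCode_constOCode)) (Primrec.const 6)
  · rw [encOCode_mem_jump]
    have : evalo (chi A) (.comp c (constOCode n)) (encOCode (.comp c (constOCode n))) =
        evalo (chi A) c n := by
      refine (congrArg (· >>= evalo (chi A) c) (evalo_constOCode (chi A) n _)).trans ?_
      exact Part.bind_some n _
    rw [this]

/-- The maximum of an `A`-computable sequence is computable from the jump of `A`. -/
theorem exists_hasOCode_pmax {A : Set ℕ} {f : List Bool × ℕ → ℕ}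
    (hf : RecInP A fun q => Part.some (f q)) :
    ∃ F : ℕ →. ℕ, HasOCode (chi (jump A)) F ∧
      ∀ p, F (Encodable.encode p) = pmax (Set.range fun t => f (p, t)) := by
  classical
  obtain ⟨c, hc⟩ := hf
  set q : ℕ → Part ℕ := fun z =>
    (evalo (chi A) c (Nat.pair z.unpair.1.unpair.1 z.unpair.2)).bind
      fun v => (Part.some z.unpair.1.unpair.2).map fun N => N + 1 - v with hq
  have hqc : HasOCode (chi A) q := by
    refine HasOCode.map₂_primrec (h := fun v N => N + 1 - v) ?_ ?_ (HasOCode.of_primrec ?_)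
    · exact Primrec.nat_sub.comp (Primrec.succ.comp Primrec.snd) Primrec.fst
    · exact HasOCode.comp_primrec ⟨c, rfl⟩ (Primrec₂.natPair.comp (Primrec.fst.comp
        (Primrec.unpair.comp (Primrec.fst.comp Primrec.unpair))) (Primrec.snd.comp Primrec.unpair))
    · exact Primrec.snd.comp (Primrec.unpair.comp (Primrec.fst.comp Primrec.unpair))
  have hqv : ∀ p N t, q (Nat.pair (Nat.pair (Encodable.encode p) N) t) =
      Part.some (N + 1 - f (p, t)) := by
    intro p N t
    have hv : evalo (chi A) c (Nat.pair (Encodable.encode p) t) = Part.some (f (p, t)) := by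
      simpa using hc (p, t)
    simp [hq, hv]
  obtain ⟨s, hs, hmem⟩ := hqc.rfind.exists_primrec_mem_jump
  have hmem' : ∀ p N, s (Nat.pair (Encodable.encode p) N) ∈ jump A ↔ ∃ t, N < f (p, t) := by
    intro p N
    refine (hmem _).trans (Nat.rfind_dom'.trans ?_)
    simp only [hqv]
    simp [Nat.sub_eq_zero_iff_le]
  refine ⟨_, HasOCode.rfind (HasOCode.oracle.comp_primrec hs), fun p => ?_⟩
  have key : ∀ n, n ∈ Nat.rfind (fun N => (fun m => decide (m = 0)) <$>
      chi (jump A) (s (Nat.pair (Encodable.encode p) N))) ↔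
      (∀ t, f (p, t) ≤ n) ∧ ∀ m < n, ∃ t, m < f (p, t) := by
    intro n
    refine Nat.mem_rfind.trans ?_
    simp [chi, hmem']
  ext n
  refine (key n).trans ?_
  have hne : (Set.range fun t => f (p, t)).Nonempty := Set.range_nonempty _
  constructor
  · rintro ⟨h₁, h₂⟩
    have hb : BddAbove (Set.range fun t => f (p, t)) := ⟨n, by rintro _ ⟨t, rfl⟩; exact h₁ t⟩
    refine ⟨⟨hne, hb⟩, ?_⟩
    refine csSup_eq_of_forall_le_of_forall_lt_exists_gt hne (by rintro _ ⟨t, rfl⟩; exact h₁ t) ?_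
    intro m hm
    obtain ⟨t, ht⟩ := h₂ m hm
    exact ⟨_, ⟨t, rfl⟩, ht⟩
  · rintro ⟨⟨-, hb⟩, rfl⟩
    refine ⟨fun t => le_csSup hb ⟨t, rfl⟩, fun m hm => ?_⟩
    obtain ⟨_, ⟨t, rfl⟩, ht⟩ := exists_lt_of_lt_csSup hne hm
    exact ⟨t, ht⟩

theorem RecInP.of_pmax_sub_pmax {A : Set ℕ} {G : List Bool →. ℤ} {f g : List Bool × ℕ → ℕ}
    (hf : RecInP A fun q => Part.some (f q)) (hg : RecInP A fun q => Part.some (g q))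
    (hG : ∀ p, G p = psub (pmax (Set.range fun t => f (p, t)))
      (pmax (Set.range fun t => g (p, t)))) :
    RecInP (jump A) G := by
  obtain ⟨F, hF, hFp⟩ := exists_hasOCode_pmax hf
  obtain ⟨F', hF', hFp'⟩ := exists_hasOCode_pmax hg
  obtain ⟨c, hc⟩ := HasOCode.map₂_primrec primrec_encode_sub hF hF'
  refine ⟨c, fun p => ?_⟩
  rw [hc, hG, ← hFp, ← hFp']
  ext y
  simp [psub, Part.mem_map_iff, Part.mem_bind_iff]
  aesop

/-- A claim `(e, n, y)` that the oracle code numbered `e` evaluates to `y` on input `n`. -/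
abbrev EvalClaim : Type := ℕ × ℕ × ℕ

/-- The claim `x` holds outright, or is an oracle query. -/
def EvalClaim.Atomic (x : EvalClaim) : Prop :=
  (x.1 = 0 ∧ x.2.2 = 0) ∨ (x.1 = 1 ∧ x.2.2 = x.2.1 + 1) ∨ (x.1 = 2 ∧ x.2.2 = x.2.1.unpair.1) ∨
    (x.1 = 3 ∧ x.2.2 = x.2.1.unpair.2) ∨ x.1 = 4

/-- The claim `x` follows from the claims `u` and `v` by one evaluation rule. -/
def EvalClaim.Follows (x u v : EvalClaim) : Prop :=
  (x.1 = 4 * Nat.pair u.1 v.1 + 5 ∧ u.2.1 = x.2.1 ∧ v.2.1 = x.2.1 ∧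
    x.2.2 = Nat.pair u.2.2 v.2.2) ∨
  (x.1 = 4 * Nat.pair v.1 u.1 + 6 ∧ u.2.1 = x.2.1 ∧ v.2.1 = u.2.2 ∧ x.2.2 = v.2.2) ∨
  (x.1 = 4 * ((x.1 - 7) / 4) + 7 ∧ u.1 = ((x.1 - 7) / 4).unpair.1 ∧ x.2.1 = Nat.pair u.2.1 0 ∧
    x.2.2 = u.2.2) ∨
  (x.1 = 4 * ((x.1 - 7) / 4) + 7 ∧ u.1 = x.1 ∧ v.1 = ((x.1 - 7) / 4).unpair.2 ∧
    x.2.1 = Nat.pair u.2.1.unpair.1 (u.2.1.unpair.2 + 1) ∧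
    v.2.1 = Nat.pair u.2.1.unpair.1 (Nat.pair u.2.1.unpair.2 u.2.2) ∧ x.2.2 = v.2.2) ∨
  (x.1 = 4 * u.1 + 8 ∧ u.2.1 = x.2.1 ∧ u.2.2 = 0 ∧ x.2.2 = x.2.1.unpair.2) ∨
  (x.1 = 4 * u.1 + 8 ∧ u.2.1 = x.2.1 ∧ u.2.2 ≠ 0 ∧ v.1 = x.1 ∧
    v.2.1 = Nat.pair x.2.1.unpair.1 (x.2.1.unpair.2 + 1) ∧ x.2.2 = v.2.2)

/-- The claim `x` follows from the claims in `L` by at most one evaluation rule. -/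
def EvalClaim.Justified (L : List EvalClaim) (x : EvalClaim) : Prop :=
  x.Atomic ∨ ∃ u ∈ L, ∃ v ∈ L, x.Follows u v

/-- Every claim in the list is justified by the claims after it. -/
def IsDerivation : List EvalClaim → Prop
  | [] => True
  | x :: L => x.Justified L ∧ IsDerivation L

/-- The oracle queries in `L` are answered according to `O`. -/
def OracleCorrect (O : ℕ →. ℕ) (L : List EvalClaim) : Prop :=
  ∀ x ∈ L, x.1 = 4 → x.2.2 ∈ O x.2.1

/-- The claim `x` has a derivation with correctly answered oracle queries. -/
def Derivable (O : ℕ →. ℕ) (x : EvalClaim) : Prop :=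
  ∃ L, IsDerivation L ∧ OracleCorrect O L ∧ x ∈ L

theorem EvalClaim.Justified.mono {L L' : List EvalClaim} {x : EvalClaim} (h : x.Justified L)
    (hL : L ⊆ L') : x.Justified L' := by
  rcases h with h | ⟨u, hu, v, hv, h⟩
  exacts [.inl h, .inr ⟨u, hL hu, v, hL hv, h⟩]

theorem IsDerivation.append {L L' : List EvalClaim} (h : IsDerivation L) (h' : IsDerivation L') :
    IsDerivation (L ++ L') := by
  induction L with
  | nil => exact h'
  | cons x L ih => exact ⟨h.1.mono (List.subset_append_left _ _), ih h.2⟩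

theorem Derivable.of_atomic {O : ℕ →. ℕ} {x : EvalClaim} (h : x.Atomic)
    (hO : x.1 = 4 → x.2.2 ∈ O x.2.1) : Derivable O x :=
  ⟨[x], ⟨.inl h, trivial⟩, by simpa [OracleCorrect] using hO, by simp⟩

theorem Derivable.of_follows {O : ℕ →. ℕ} {x u v : EvalClaim} (hu : Derivable O u)
    (hv : Derivable O v) (h : x.Follows u v) : Derivable O x := by
  obtain ⟨L, hL, hLO, huL⟩ := hu
  obtain ⟨M, hM, hMO, hvM⟩ := hv
  refine ⟨x :: (L ++ M), ⟨.inr ⟨u, by simp [huL], v, by simp [hvM], h⟩, hL.append hM⟩, ?_,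
    by simp⟩
  intro z hz h4
  rcases List.mem_cons.1 hz with rfl | hz
  · rcases h with h | h | h | h | h | h <;> omega
  · rcases List.mem_append.1 hz with hz | hz
    exacts [hLO z hz h4, hMO z hz h4]

theorem mem_evalo_rfind' {O : ℕ →. ℕ} {c : OCode} {a m y : ℕ} :
    y ∈ evalo O (.rfind' c) (Nat.pair a m) ↔ ∃ k, y = k + m ∧ 0 ∈ evalo O c (Nat.pair a (k + m)) ∧
      ∀ j < k, ∃ v ≠ 0, v ∈ evalo O c (Nat.pair a (j + m)) := by
  simp only [evalo, Nat.unpaired, Nat.unpair_pair]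
  refine (Part.mem_map_iff _).trans (exists_congr fun k => ?_)
  refine (and_congr_left' Nat.mem_rfind).trans ?_
  have hne : ∀ j, (∃ v ≠ 0, v ∈ evalo O c (Nat.pair a (j + m))) ↔
      ∃ v, v + 1 ∈ evalo O c (Nat.pair a (j + m)) := fun j =>
    ⟨fun ⟨v, hv, h⟩ => ⟨v - 1, by rwa [Nat.sub_add_cancel (Nat.one_le_iff_ne_zero.2 hv)]⟩,
      fun ⟨v, h⟩ => ⟨v + 1, v.succ_ne_zero, h⟩⟩
  simp only [hne]
  simp
  constructor
  · rintro ⟨⟨h₁, h₂⟩, rfl⟩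
    exact ⟨rfl, h₁, fun j hj => (hne j).1 ((h₂ hj).imp fun v h => h.symm)⟩
  · rintro ⟨rfl, h₁, h₂⟩
    exact ⟨⟨h₁, fun {j} hj => ((hne j).2 (h₂ j hj)).imp fun v h => h.symm⟩, rfl⟩

theorem Derivable.of_mem_evalo {O : ℕ →. ℕ} (c : OCode) {n y : ℕ} (h : y ∈ evalo O c n) :
    Derivable O (encOCode c, n, y) := by
  induction c generalizing n y with
  | zero | succ | left | right =>
    simp only [evalo, Part.mem_some_iff] at h
    subst h
    exact .of_atomic (by simp [EvalClaim.Atomic, encOCode]) (by simp [encOCode])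
  | oracle => exact .of_atomic (by simp [EvalClaim.Atomic, encOCode]) fun _ => h
  | pair c d ihc ihd =>
    simp [evalo, Seq.seq] at h
    obtain ⟨u, hu, v, hv, rfl⟩ := h
    exact (ihc hu).of_follows (ihd hv) (.inl ⟨rfl, rfl, rfl, rfl⟩)
  | comp c d ihc ihd =>
    obtain ⟨u, hu, hy⟩ := Part.mem_bind_iff.1 h
    exact (ihd hu).of_follows (ihc hy) (.inr (.inl ⟨rfl, rfl, rfl, rfl⟩))
  | prec c d ihc ihd =>
    obtain ⟨a, m, rfl⟩ : ∃ a m, n = Nat.pair a m := ⟨_, _, (Nat.pair_unpair n).symm⟩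
    simp only [evalo, Nat.unpaired, Nat.unpair_pair] at h
    have e7 : (encOCode (.prec c d) - 7) / 4 = Nat.pair (encOCode c) (encOCode d) := by
      simp [encOCode]
    induction m generalizing y with
    | zero =>
      refine (ihc h).of_follows (ihc h) (.inr (.inr (.inl ⟨?_, ?_, rfl, rfl⟩)))
      · rw [e7]; rfl
      · rw [e7, Nat.unpair_pair]
    | succ m ih =>
      obtain ⟨i, hi, hy⟩ := Part.mem_bind_iff.1 h
      refine (ih hi).of_follows (ihd hy) (.inr (.inr (.inr (.inl ⟨?_, rfl, ?_, ?_, ?_, rfl⟩))))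
      · rw [e7]; rfl
      · rw [e7, Nat.unpair_pair]
      · simp
      · simp
  | rfind' c ih =>
    obtain ⟨a, m, rfl⟩ : ∃ a m, n = Nat.pair a m := ⟨_, _, (Nat.pair_unpair n).symm⟩
    obtain ⟨k, rfl, h0, hk⟩ := mem_evalo_rfind'.1 h
    clear h
    induction k generalizing m with
    | zero =>
      rw [Nat.zero_add] at h0 ⊢
      exact (ih h0).of_follows (ih h0) (.inr (.inr (.inr (.inr (.inl ⟨rfl, rfl, rfl, by simp⟩)))))
    | succ k ihk =>
      obtain ⟨v, hv0, hv⟩ := hk 0 k.succ_pos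
      rw [Nat.zero_add] at hv
      have := ihk (m + 1) (by rwa [show k + (m + 1) = k + 1 + m by omega]) fun j hj => by
        rw [show j + (m + 1) = j + 1 + m by omega]
        exact hk (j + 1) (by omega)
      exact (ih hv).of_follows this
        (.inr (.inr (.inr (.inr (.inr ⟨rfl, rfl, hv0, rfl, by simp, by simp; omega⟩)))))

theorem IsDerivation.mem_evalo {O : ℕ →. ℕ} {L : List EvalClaim} (h : IsDerivation L)
    (hO : OracleCorrect O L) {c : OCode} {n y : ℕ} (hc : (encOCode c, n, y) ∈ L) :
    y ∈ evalo O c n := by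
  induction L generalizing c n y with
  | nil => simp at hc
  | cons x L ih =>
    replace ih := @ih h.2 fun z hz => hO z (List.mem_cons_of_mem _ hz)
    have h4 := hO x (by simp)
    have hx := h.1
    clear hO h
    rcases List.mem_cons.1 hc with rfl | hc
    swap
    · exact ih hc
    clear hc
    rcases hx with hx | ⟨⟨u, p, i⟩, hu, ⟨v, q, j⟩, hv, hx⟩
    · simp only [EvalClaim.Atomic] at hx
      cases c <;> simp only [encOCode] at hx h4 <;> first | omega | skip
      · simpa [evalo] using hx
      · simpa [evalo] using hx
      · simpa [evalo] using hx
      · simpa [evalo] using hx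
      · exact h4 trivial
    · simp only [EvalClaim.Follows] at hx
      cases c with
      | zero | succ | left | right | oracle => simp only [encOCode] at hx; omega
      | pair c d =>
        simp only [encOCode] at hx
        obtain ⟨h₁, rfl, rfl, rfl⟩ := hx.resolve_right (by omega)
        obtain ⟨rfl, rfl⟩ := Nat.pair_eq_pair.1
          (by omega : Nat.pair (encOCode c) (encOCode d) = Nat.pair u v)
        have := ih hu
        have := ih hv
        simp [evalo, Seq.seq]
        aesop
      | comp c d =>
        simp only [encOCode] at hx
        obtain ⟨h₁, rfl, rfl, rfl⟩ := (hx.resolve_left (by omega)).resolve_right (by omega)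
        obtain ⟨rfl, rfl⟩ := Nat.pair_eq_pair.1
          (by omega : Nat.pair (encOCode c) (encOCode d) = Nat.pair v u)
        exact Part.mem_bind_iff.2 ⟨_, ih hu, ih hv⟩
      | prec c d =>
        simp only [encOCode, Nat.add_sub_cancel, Nat.mul_div_cancel_left _ (by norm_num : 0 < 4),
          Nat.unpair_pair] at hx
        rcases hx with hx | hx | ⟨-, rfl, rfl, rfl⟩ | ⟨-, rfl, rfl, rfl, rfl, rfl⟩ | hx | hx
        · omega
        · omega
        · simpa [evalo] using ih hu
        · obtain ⟨a, m, rfl⟩ : ∃ a m, p = Nat.pair a m := ⟨_, _, (Nat.pair_unpair p).symm⟩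
          have h₁ := ih (c := .prec c d) hu
          have h₂ := ih hv
          simp only [evalo, Nat.unpaired, Nat.unpair_pair] at h₁ h₂ ⊢
          exact Part.mem_bind_iff.2 ⟨_, h₁, h₂⟩
        · omega
        · omega
      | rfind' c =>
        simp only [encOCode] at hx
        obtain ⟨a, m, rfl⟩ : ∃ a m, n = Nat.pair a m := ⟨_, _, (Nat.pair_unpair n).symm⟩
        rw [mem_evalo_rfind']
        simp only [Nat.unpair_pair] at hx
        rcases hx with hx | hx | hx | hx | ⟨h₁, rfl, rfl, rfl⟩ | ⟨h₁, rfl, hi, rfl, rfl, rfl⟩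
        · omega
        · omega
        · omega
        · omega
        · obtain rfl : encOCode c = u := by omega
          exact ⟨0, by simp, by simpa using ih hu, by simp⟩
        · obtain rfl : encOCode c = u := by omega
          obtain ⟨k, rfl, h0, hk⟩ := mem_evalo_rfind'.1 (ih (c := .rfind' c) hv)
          refine ⟨k + 1, by omega, by rwa [show k + 1 + m = k + (m + 1) by omega], fun l hl => ?_⟩
          cases l with
          | zero => exact ⟨i, hi, by simpa using ih hu⟩
          | succ l =>
            rw [show l + 1 + m = l + (m + 1) by omega]
            exact hk l (by omega)

theorem derivable_iff_mem_evalo {O : ℕ →. ℕ} {c : OCode} {n y : ℕ} :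
    Derivable O (encOCode c, n, y) ↔ y ∈ evalo O c n :=
  ⟨fun ⟨_, h, hO, hc⟩ => h.mem_evalo hO hc, .of_mem_evalo c⟩

theorem mem_jump_iff_derivable {A : Set ℕ} {m : ℕ} :
    m ∈ jump A ↔ ∃ y, Derivable (chi A) (m, m, y) := by
  obtain ⟨c, rfl⟩ := encOCode_surjective m
  simp [encOCode_mem_jump, derivable_iff_mem_evalo, Part.dom_iff_mem]

theorem EvalClaim.primrec_follows :
    PrimrecPred fun z : EvalClaim × EvalClaim × EvalClaim => z.1.Follows z.2.1 z.2.2 := by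
  have x1 : Primrec fun z : EvalClaim × EvalClaim × EvalClaim => z.1.1 :=
    Primrec.fst.comp Primrec.fst
  have x2 : Primrec fun z : EvalClaim × EvalClaim × EvalClaim => z.1.2.1 :=
    Primrec.fst.comp (Primrec.snd.comp Primrec.fst)
  have x3 : Primrec fun z : EvalClaim × EvalClaim × EvalClaim => z.1.2.2 :=
    Primrec.snd.comp (Primrec.snd.comp Primrec.fst)
  have u1 : Primrec fun z : EvalClaim × EvalClaim × EvalClaim => z.2.1.1 :=
    Primrec.fst.comp (Primrec.fst.comp Primrec.snd)
  have u2 : Primrec fun z : EvalClaim × EvalClaim × EvalClaim => z.2.1.2.1 :=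
    Primrec.fst.comp (Primrec.snd.comp (Primrec.fst.comp Primrec.snd))
  have u3 : Primrec fun z : EvalClaim × EvalClaim × EvalClaim => z.2.1.2.2 :=
    Primrec.snd.comp (Primrec.snd.comp (Primrec.fst.comp Primrec.snd))
  have v1 : Primrec fun z : EvalClaim × EvalClaim × EvalClaim => z.2.2.1 :=
    Primrec.fst.comp (Primrec.snd.comp Primrec.snd)
  have v2 : Primrec fun z : EvalClaim × EvalClaim × EvalClaim => z.2.2.2.1 :=
    Primrec.fst.comp (Primrec.snd.comp (Primrec.snd.comp Primrec.snd))
  have v3 : Primrec fun z : EvalClaim × EvalClaim × EvalClaim => z.2.2.2.2 :=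
    Primrec.snd.comp (Primrec.snd.comp (Primrec.snd.comp Primrec.snd))
  have lin : ∀ (k : ℕ) {f : EvalClaim × EvalClaim × EvalClaim → ℕ}, Primrec f →
      Primrec fun z => 4 * f z + k := fun k _ hf =>
    Primrec.nat_add.comp (Primrec.nat_mul.comp (Primrec.const 4) hf) (Primrec.const k)
  have fstU : ∀ {f : EvalClaim × EvalClaim × EvalClaim → ℕ}, Primrec f →
      Primrec fun z => (f z).unpair.1 := fun hf => Primrec.fst.comp (Primrec.unpair.comp hf)
  have sndU : ∀ {f : EvalClaim × EvalClaim × EvalClaim → ℕ}, Primrec f →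
      Primrec fun z => (f z).unpair.2 := fun hf => Primrec.snd.comp (Primrec.unpair.comp hf)
  have eq : ∀ {f g : EvalClaim × EvalClaim × EvalClaim → ℕ}, Primrec f → Primrec g →
      PrimrecPred fun z => f z = g z := fun hf hg => Primrec.eq.comp hf hg
  have k7 : Primrec fun z : EvalClaim × EvalClaim × EvalClaim => (z.1.1 - 7) / 4 :=
    Primrec.nat_div.comp (Primrec.nat_sub.comp x1 (Primrec.const 7)) (Primrec.const 4)
  have pr := @Primrec₂.natPair
  refine .or (.and (eq x1 (lin 5 (pr.comp u1 v1))) (.and (eq u2 x2) (.and (eq v2 x2)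
    (eq x3 (pr.comp u3 v3))))) ?_
  refine .or (.and (eq x1 (lin 6 (pr.comp v1 u1))) (.and (eq u2 x2) (.and (eq v2 u3)
    (eq x3 v3)))) ?_
  refine .or (.and (eq x1 (lin 7 k7)) (.and (eq u1 (fstU k7)) (.and
    (eq x2 (pr.comp u2 (Primrec.const 0))) (eq x3 u3)))) ?_
  refine .or (.and (eq x1 (lin 7 k7)) (.and (eq u1 x1) (.and (eq v1 (sndU k7)) (.and
    (eq x2 (pr.comp (fstU u2) (Primrec.succ.comp (sndU u2)))) (.and
    (eq v2 (pr.comp (fstU u2) (pr.comp (sndU u2) u3))) (eq x3 v3)))))) ?_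
  refine .or (.and (eq x1 (lin 8 u1)) (.and (eq u2 x2) (.and (eq u3 (Primrec.const 0))
    (eq x3 (sndU x2))))) ?_
  exact .and (eq x1 (lin 8 u1)) (.and (eq u2 x2) (.and (.not (eq u3 (Primrec.const 0)))
    (.and (eq v1 x1) (.and (eq v2 (pr.comp (fstU x2) (Primrec.succ.comp (sndU x2))))
    (eq x3 v3)))))

theorem EvalClaim.primrec_atomic : PrimrecPred EvalClaim.Atomic := by
  have x1 : Primrec fun z : EvalClaim => z.1 := Primrec.fst
  have x2 : Primrec fun z : EvalClaim => z.2.1 := Primrec.fst.comp Primrec.snd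
  have x3 : Primrec fun z : EvalClaim => z.2.2 := Primrec.snd.comp Primrec.snd
  have eq : ∀ {f g : EvalClaim → ℕ}, Primrec f → Primrec g →
      PrimrecPred fun z => f z = g z := fun hf hg => Primrec.eq.comp hf hg
  have e1 : ∀ k : ℕ, PrimrecPred fun z : EvalClaim => z.1 = k := fun k => eq x1 (Primrec.const k)
  exact .or (.and (e1 0) (eq x3 (Primrec.const 0))) (.or (.and (e1 1) (eq x3 (Primrec.succ.comp x2)))
    (.or (.and (e1 2) (eq x3 (Primrec.fst.comp (Primrec.unpair.comp x2))))
    (.or (.and (e1 3) (eq x3 (Primrec.snd.comp (Primrec.unpair.comp x2)))) (e1 4))))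

theorem EvalClaim.primrec_justified :
    PrimrecPred fun z : EvalClaim × List EvalClaim => z.1.Justified z.2 := by
  have h₁ : PrimrecRel fun (v : EvalClaim) (z : EvalClaim × EvalClaim) => z.1.Follows z.2 v :=
    primrec_follows.comp (f := fun w : EvalClaim × EvalClaim × EvalClaim => (w.2.1, w.2.2, w.1))
      (Primrec.pair (Primrec.fst.comp Primrec.snd)
        (Primrec.pair (Primrec.snd.comp Primrec.snd) Primrec.fst))
  have h₂ : PrimrecRel fun (u : EvalClaim) (z : EvalClaim × List EvalClaim) =>
      ∃ v ∈ z.2, z.1.Follows u v :=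
    h₁.exists_mem_list.comp (Primrec.snd.comp Primrec.snd)
      (Primrec.pair (Primrec.fst.comp Primrec.snd) Primrec.fst)
  exact .or (primrec_atomic.comp Primrec.fst) (h₂.exists_mem_list.comp Primrec.snd Primrec.id)

theorem primrec_isDerivation : PrimrecPred IsDerivation := by
  classical
  have h : Primrec fun L : List EvalClaim => (List.recOn L true
      fun x M IH => decide (x.Justified M) && IH : Bool) :=
    Primrec.list_rec (h := fun (_ : List EvalClaim) (w : EvalClaim × List EvalClaim × Bool) =>
        decide (w.1.Justified w.2.1) && w.2.2)
      Primrec.id (Primrec.const true) <| Primrec.and.comp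
        ((EvalClaim.primrec_justified.comp (Primrec.pair Primrec.fst
          (Primrec.fst.comp Primrec.snd))).decide.comp Primrec.snd)
        (Primrec.snd.comp (Primrec.snd.comp Primrec.snd))
  refine ⟨Classical.decPred _, h.of_eq fun L => ?_⟩
  induction L with
  | nil => exact (decide_eq_true (p := IsDerivation []) trivial).symm
  | cons x L ih =>
    simp only [ih]
    rw [Bool.eq_iff_iff, Bool.and_eq_true, decide_eq_true_eq, decide_eq_true_eq, decide_eq_true_eq]
    rfl

/-- The `s`-th approximation of the jump of an oracle whose initial bits are listed in `σ`. -/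
def JumpApprox (σ : List ℕ) (m s : ℕ) : Prop :=
  ∃ w < s, IsDerivation (Denumerable.ofNat (List EvalClaim) w) ∧
    (∃ u ∈ Denumerable.ofNat (List EvalClaim) w, u.1 = m ∧ u.2.1 = m) ∧
    ∀ u ∈ Denumerable.ofNat (List EvalClaim) w, u.1 ≠ 4 ∨ (u.2.1 < s ∧ σ.getD u.2.1 0 = u.2.2)

theorem primrec_jumpApprox :
    PrimrecPred fun z : List ℕ × ℕ × ℕ => JumpApprox z.1 z.2.1 z.2.2 := by
  have ofN : Primrec (Denumerable.ofNat (List EvalClaim)) := Primrec.ofNat _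
  have h₁ : PrimrecRel fun (u : EvalClaim) (m : ℕ) => u.1 = m ∧ u.2.1 = m :=
    .and (Primrec.eq.comp (Primrec.fst.comp Primrec.fst) Primrec.snd)
      (Primrec.eq.comp (Primrec.fst.comp (Primrec.snd.comp Primrec.fst)) Primrec.snd)
  have h₂ : PrimrecRel fun (u : EvalClaim) (z : List ℕ × ℕ × ℕ) =>
      u.1 ≠ 4 ∨ (u.2.1 < z.2.2 ∧ z.1.getD u.2.1 0 = u.2.2) :=
    .or (.not (Primrec.eq.comp (Primrec.fst.comp Primrec.fst) (Primrec.const 4)))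
      (.and (Primrec.nat_lt.comp (Primrec.fst.comp (Primrec.snd.comp Primrec.fst))
        (Primrec.snd.comp (Primrec.snd.comp Primrec.snd)))
      (Primrec.eq.comp ((Primrec.list_getD 0).comp (Primrec.fst.comp Primrec.snd)
        (Primrec.fst.comp (Primrec.snd.comp Primrec.fst)))
        (Primrec.snd.comp (Primrec.snd.comp Primrec.fst))))
  have h₃ : PrimrecRel fun (w : ℕ) (z : List ℕ × ℕ × ℕ) =>
      IsDerivation (Denumerable.ofNat (List EvalClaim) w) ∧
      (∃ u ∈ Denumerable.ofNat (List EvalClaim) w, u.1 = z.2.1 ∧ u.2.1 = z.2.1) ∧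
      ∀ u ∈ Denumerable.ofNat (List EvalClaim) w,
        u.1 ≠ 4 ∨ (u.2.1 < z.2.2 ∧ z.1.getD u.2.1 0 = u.2.2) :=
    .and (primrec_isDerivation.comp (ofN.comp Primrec.fst))
      (.and (h₁.exists_mem_list.comp (ofN.comp Primrec.fst)
        (Primrec.fst.comp (Primrec.snd.comp Primrec.snd)))
        (h₂.forall_mem_list.comp (ofN.comp Primrec.fst) Primrec.snd))
  exact (h₃.exists_mem_list.comp (Primrec.list_range.comp (Primrec.snd.comp Primrec.snd))
    Primrec.id).of_eq fun z => by simp [JumpApprox]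

/-- At stage `t`, the number `a` looks like a correct derivation showing that code `e` evaluates on
input `n` to `a.unpair.1`, relative to an oracle with approximations `J`. Positive oracle answers
must be confirmed by a stage recorded in `a`; negative ones must not be refuted by stage `t`. -/
def Plausible (J : ℕ → ℕ → Prop) (e n t a : ℕ) : Prop :=
  IsDerivation (Denumerable.ofNat (List EvalClaim) a.unpair.2.unpair.1) ∧
    (∃ u ∈ Denumerable.ofNat (List EvalClaim) a.unpair.2.unpair.1, u = (e, n, a.unpair.1)) ∧
    ∀ u ∈ Denumerable.ofNat (List EvalClaim) a.unpair.2.unpair.1, u.1 ≠ 4 ∨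
      (u.2.2 = 1 ∧ J u.2.1 a.unpair.2.unpair.2) ∨ (u.2.2 = 0 ∧ ¬ J u.2.1 t)

open Classical in
/-- The least plausible number below `t`, or `t` if there is none. -/
noncomputable def guess (J : ℕ → ℕ → Prop) (e n t : ℕ) : ℕ :=
  (List.range t).findIdx fun a => decide (Plausible J e n t a)

theorem primrec_guess (e : ℕ) :
    Primrec fun z : List ℕ × ℕ × ℕ => guess (JumpApprox z.1) e z.2.1 z.2.2 := by
  classical
  have s1 : Primrec fun z : ℕ × (List ℕ × ℕ × ℕ) => z.1.unpair.1 :=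
    Primrec.fst.comp (Primrec.unpair.comp Primrec.fst)
  have s2 : Primrec fun z : ℕ × (List ℕ × ℕ × ℕ) => z.1.unpair.2.unpair :=
    Primrec.unpair.comp (Primrec.snd.comp (Primrec.unpair.comp Primrec.fst))
  have sL : Primrec fun z : ℕ × (List ℕ × ℕ × ℕ) =>
      Denumerable.ofNat (List EvalClaim) z.1.unpair.2.unpair.1 :=
    (Primrec.ofNat _).comp (Primrec.fst.comp s2)
  have u2 : Primrec fun z : EvalClaim × (ℕ × List ℕ × ℕ × ℕ) => z.1.2.1 :=
    Primrec.fst.comp (Primrec.snd.comp Primrec.fst)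
  have u3 : Primrec fun z : EvalClaim × (ℕ × List ℕ × ℕ × ℕ) => z.1.2.2 :=
    Primrec.snd.comp (Primrec.snd.comp Primrec.fst)
  have σ : Primrec fun z : EvalClaim × (ℕ × List ℕ × ℕ × ℕ) => z.2.2.1 :=
    Primrec.fst.comp (Primrec.snd.comp Primrec.snd)
  have h₁ : PrimrecRel fun (u : EvalClaim) (z : ℕ × (List ℕ × ℕ × ℕ)) => u.1 ≠ 4 ∨
      (u.2.2 = 1 ∧ JumpApprox z.2.1 u.2.1 z.1.unpair.2.unpair.2) ∨
      (u.2.2 = 0 ∧ ¬ JumpApprox z.2.1 u.2.1 z.2.2.2) :=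
    .or (.not (Primrec.eq.comp (Primrec.fst.comp Primrec.fst) (Primrec.const 4)))
      (.or (.and (Primrec.eq.comp u3 (Primrec.const 1))
          (primrec_jumpApprox.comp (σ.pair (u2.pair ((Primrec.snd.comp s2).comp Primrec.snd)))))
        (.and (Primrec.eq.comp u3 (Primrec.const 0)) (.not (primrec_jumpApprox.comp
          (σ.pair (u2.pair (Primrec.snd.comp (Primrec.snd.comp
            (Primrec.snd.comp Primrec.snd)))))))))
  have h₂ : PrimrecPred fun z : ℕ × (List ℕ × ℕ × ℕ) =>
      Plausible (JumpApprox z.2.1) e z.2.2.1 z.2.2.2 z.1 :=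
    .and (primrec_isDerivation.comp sL) (.and
      (Primrec.eq.exists_mem_list.comp sL ((Primrec.const e).pair
        ((Primrec.fst.comp (Primrec.snd.comp Primrec.snd)).pair s1)))
      (h₁.forall_mem_list.comp sL Primrec.id))
  refine Primrec.list_findIdx (Primrec.list_range.comp (Primrec.snd.comp Primrec.snd)) ?_
  exact (h₂.decide.comp (Primrec.snd.pair Primrec.fst)).of_eq fun z => by congr

section Guess

variable {J J' : ℕ → ℕ → Prop} {e n s t a : ℕ}

theorem Plausible.anti (hJ : ∀ m s t, s ≤ t → J m s → J m t) (hst : s ≤ t)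
    (h : Plausible J e n t a) : Plausible J e n s a :=
  ⟨h.1, h.2.1, fun u hu => (h.2.2 u hu).imp_right <| Or.imp_right <|
    And.imp_right fun h₁ h₂ => h₁ (hJ _ _ _ hst h₂)⟩

theorem plausible_congr (h : ∀ m s, s ≤ t → (J m s ↔ J' m s)) (ha : a < t) :
    Plausible J e n t a ↔ Plausible J' e n t a := by
  have hs : a.unpair.2.unpair.2 ≤ t :=
    ((Nat.unpair_right_le _).trans (Nat.unpair_right_le _)).trans ha.le
  simp only [Plausible, h _ _ hs, h _ _ le_rfl]

theorem guess_le : guess J e n t ≤ t :=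
  List.findIdx_le_length.trans_eq List.length_range

theorem plausible_guess (h : guess J e n t < t) : Plausible J e n t (guess J e n t) := by
  classical
  have := List.findIdx_getElem (p := fun a => decide (Plausible J e n t a))
    (xs := List.range t) (w := by rw [List.length_range]; exact h)
  simp only [List.getElem_range, decide_eq_true_eq] at this
  exact this

theorem guess_le_of_plausible (ha : Plausible J e n t a) : guess J e n t ≤ a := by
  classical
  rcases lt_or_ge a t with hat | hat
  · by_contra! hlt
    have := List.not_of_lt_findIdx (p := fun a => decide (Plausible J e n t a))
      (xs := List.range t) (i := a) hlt
    simp [ha] at this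
  · exact guess_le.trans hat

theorem guess_congr (h : ∀ m s, s ≤ t → (J m s ↔ J' m s)) : guess J e n t = guess J' e n t := by
  refine le_antisymm ?_ ?_
  · rcases (guess_le (J := J') (e := e) (n := n) (t := t)).lt_or_eq with hl | hl
    · exact guess_le_of_plausible ((plausible_congr h hl).2 (plausible_guess hl))
    · exact guess_le.trans_eq hl.symm
  · rcases (guess_le (J := J) (e := e) (n := n) (t := t)).lt_or_eq with hl | hl
    · exact guess_le_of_plausible ((plausible_congr h hl).1 (plausible_guess hl))
    · exact guess_le.trans_eq hl.symm

theorem plausible_of_isGreatest_guess (hJ : ∀ m s t, s ≤ t → J m s → J m t)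
    (h : IsGreatest (Set.range (guess J e n)) a) (t : ℕ) : Plausible J e n t a := by
  obtain ⟨⟨t₀, rfl⟩, hmax⟩ := h
  have hmono : ∀ t ≥ t₀, guess J e n t = guess J e n t₀ := by
    intro t ht
    refine le_antisymm (hmax ⟨t, rfl⟩) ?_
    rcases (guess_le (J := J) (e := e) (n := n) (t := t)).lt_or_eq with hl | hl
    · exact guess_le_of_plausible ((plausible_guess hl).anti hJ ht)
    · exact guess_le.trans (hl.symm ▸ ht)
  have h₁ := hmono (t₀ + t + 1) (by omega)
  have h₂ : guess J e n t₀ ≤ t₀ := guess_le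
  exact h₁ ▸ (plausible_guess (by omega)).anti hJ (by omega)

open Classical in
theorem mem_chi {B : Set ℕ} {m v : ℕ} : v ∈ chi B m ↔ (v = 1 ∧ m ∈ B) ∨ (v = 0 ∧ m ∉ B) := by
  by_cases h : m ∈ B
  · simp [chi, h]
  · simp [chi, h]

theorem mem_evalo_of_forall_plausible {c : OCode}
    (h : ∀ t, Plausible J (encOCode c) n t a) :
    a.unpair.1 ∈ evalo (chi {m | ∃ s, J m s}) c n := by
  obtain ⟨hL, ⟨u, hu, rfl⟩, -⟩ := h 0
  refine hL.mem_evalo (fun x hx h4 => mem_chi.2 ?_) hu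
  by_cases hm : ∃ s, J x.2.1 s
  · obtain ⟨s, hs⟩ := hm
    rcases (h s).2.2 x hx with h' | h' | h'
    exacts [absurd h4 h', .inl ⟨h'.1, _, hs⟩, absurd hs h'.2]
  · rcases (h 0).2.2 x hx with h' | h' | h'
    exacts [absurd h4 h', absurd ⟨_, h'.2⟩ hm, .inr ⟨h'.1, hm⟩]

theorem exists_forall_plausible (hJ : ∀ m s t, s ≤ t → J m s → J m t) {c : OCode} {y : ℕ}
    (h : y ∈ evalo (chi {m | ∃ s, J m s}) c n) : ∃ a, ∀ t, Plausible J (encOCode c) n t a := by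
  obtain ⟨L, hL, hO, hu⟩ := Derivable.of_mem_evalo c h
  have hs : ∃ s, ∀ u ∈ L, (∃ s, J u.2.1 s) → J u.2.1 s := by
    clear hL hO hu
    induction L with
    | nil => exact ⟨0, by simp⟩
    | cons x L ih =>
      obtain ⟨s, hs⟩ := ih
      by_cases hx : ∃ s, J x.2.1 s
      · obtain ⟨s', hs'⟩ := hx
        refine ⟨max s s', fun u hu hJu => ?_⟩
        rcases List.mem_cons.1 hu with rfl | hu
        exacts [hJ _ _ _ (le_max_right _ _) hs', hJ _ _ _ (le_max_left _ _) (hs u hu hJu)]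
      · refine ⟨s, fun u hu hJu => ?_⟩
        rcases List.mem_cons.1 hu with rfl | hu
        exacts [absurd hJu hx, hs u hu hJu]
  obtain ⟨s, hs⟩ := hs
  refine ⟨Nat.pair y (Nat.pair (Encodable.encode L) s), fun t => ?_⟩
  simp only [Plausible, Nat.unpair_pair, Denumerable.ofNat_encode]
  refine ⟨hL, ⟨_, hu, rfl⟩, fun u hu => ?_⟩
  by_cases h4 : u.1 = 4
  · rcases mem_chi.1 (hO u hu h4) with ⟨h₁, h₂⟩ | ⟨h₁, h₂⟩
    exacts [.inr (.inl ⟨h₁, hs u hu h₂⟩), .inr (.inr ⟨h₁, fun h => h₂ ⟨_, h⟩⟩)]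
  · exact .inl h4

end Guess

open Classical in
/-- The first `t` bits of the set `A`. -/
noncomputable def bits (A : Set ℕ) (t : ℕ) : List ℕ :=
  (List.range t).map fun m => if m ∈ A then 1 else 0

open Classical in
theorem getD_bits {A : Set ℕ} {m t : ℕ} (h : m < t) :
    (bits A t).getD m 0 = if m ∈ A then 1 else 0 := by
  simp [bits, List.getD, h]

theorem hasOCode_bits (A : Set ℕ) :
    HasOCode (chi A) fun t => Part.some (Encodable.encode (bits A t)) := by
  classical
  have hstep : Primrec₂ fun (v z : ℕ) => Encodable.encode
      (Denumerable.ofNat (List ℕ) z.unpair.2.unpair.2 ++ [v]) := by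
    refine Primrec.encode.comp (Primrec.list_append.comp ((Primrec.ofNat _).comp
      (Primrec.snd.comp (Primrec.unpair.comp (Primrec.snd.comp (Primrec.unpair.comp
        Primrec.snd))))) (Primrec.list_cons.comp Primrec.fst (Primrec.const [])))
  have h₁ := HasOCode.map₂_primrec hstep
    ((HasOCode.oracle (O := chi A)).comp_primrec (h := fun z : ℕ => z.unpair.2.unpair.1)
      (Primrec.fst.comp (Primrec.unpair.comp (Primrec.snd.comp Primrec.unpair))))
    (HasOCode.of_primrec Primrec.id)
  have h₀ := HasOCode.of_primrec (O := chi A) (Primrec.const (Encodable.encode ([] : List ℕ)))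
  refine ((h₀.prec h₁).comp_primrec (h := fun t => Nat.pair 0 t)
    (Primrec₂.natPair.comp (Primrec.const 0) Primrec.id)).of_eq fun t => ?_
  simp only [Nat.unpaired, Nat.unpair_pair]
  induction t with
  | zero => rfl
  | succ t ih =>
    refine (congrArg (fun x : Part ℕ => x.bind _) ih).trans ?_
    simp [chi, bits, List.range_succ]

/-- Stages of an enumeration of the jump of `A`. -/
def JumpStage (A : Set ℕ) (m s : ℕ) : Prop := JumpApprox (bits A s) m s

theorem jumpApprox_bits {A : Set ℕ} {m s t : ℕ} (h : s ≤ t) :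
    JumpApprox (bits A t) m s ↔ JumpStage A m s := by
  have hb : ∀ k v, (k < s ∧ (bits A t).getD k 0 = v) ↔ (k < s ∧ (bits A s).getD k 0 = v) :=
    fun k v => and_congr_right fun hk => by rw [getD_bits hk, getD_bits (hk.trans_le h)]
  simp only [JumpStage, JumpApprox, hb]

theorem JumpStage.mono {A : Set ℕ} (m s t : ℕ) (h : s ≤ t) (hs : JumpStage A m s) :
    JumpStage A m t := by
  obtain ⟨w, hw, hL, hu, hO⟩ := (jumpApprox_bits h).2 hs
  exact ⟨w, hw.trans_le h, hL, hu, fun u hu => (hO u hu).imp_right fun h' => ⟨h'.1.trans_le h, h'.2⟩⟩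

theorem exists_jumpStage {A : Set ℕ} : {m | ∃ s, JumpStage A m s} = jump A := by
  classical
  ext m
  refine Iff.trans ?_ mem_jump_iff_derivable.symm
  constructor
  · rintro ⟨s, w, hw, hL, ⟨⟨m', n', y⟩, hu, hm, hn⟩, hO⟩
    obtain rfl : m' = m := hm
    obtain rfl : n' = m' := hn
    refine ⟨y, _, hL, fun u hu h4 => ?_, hu⟩
    obtain ⟨h₁, h₂⟩ := (hO u hu).resolve_left (not_not.2 h4)
    rw [← h₂, getD_bits h₁]
    exact Part.mem_some _
  · rintro ⟨y, L, hL, hO, hu⟩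
    obtain ⟨s, hs⟩ : ∃ s, ∀ u ∈ L, u.2.1 < s :=
      ⟨(L.map fun u => u.2.1).sum + 1, fun u hu =>
        Nat.lt_succ_of_le (List.le_sum_of_mem (List.mem_map_of_mem hu))⟩
    refine ⟨Encodable.encode L + 1 + s, Encodable.encode L, by omega, ?_⟩
    simp only [Denumerable.ofNat_encode]
    refine ⟨hL, ⟨_, hu, rfl, rfl⟩, fun u hu => or_iff_not_imp_left.2 fun h4 => ?_⟩
    have hlt : u.2.1 < Encodable.encode L + 1 + s := (hs u hu).trans_le (by omega)
    refine ⟨hlt, ?_⟩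
    rw [getD_bits hlt]
    exact (Part.mem_some_iff.1 (hO u hu (not_not.1 h4))).symm

/-- The square of `a`, shifted by the integer encoded by the first component of `a`. -/
def shiftedSq (a : ℕ) : ℕ :=
  if a.unpair.1 % 2 = 0 then a * a + a.unpair.1 / 2 else a * a - (a.unpair.1 / 2 + 1)

theorem primrec_shiftedSq : Primrec shiftedSq := by
  have hu : Primrec fun a : ℕ => a.unpair.1 := Primrec.fst.comp Primrec.unpair
  have hd : Primrec fun a : ℕ => a.unpair.1 / 2 := Primrec.nat_div.comp hu (Primrec.const 2)
  have hsq : Primrec fun a : ℕ => a * a := Primrec.nat_mul.comp Primrec.id Primrec.id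
  exact Primrec.ite (Primrec.eq.comp (Primrec.nat_mod.comp hu (Primrec.const 2)) (Primrec.const 0))
    (Primrec.nat_add.comp hsq hd) (Primrec.nat_sub.comp hsq (Primrec.succ.comp hd))

theorem shiftedSq_sub (a : ℕ) {z : ℤ} (hz : Encodable.encode z = a.unpair.1) :
    (shiftedSq a : ℤ) - (a * a : ℕ) = z := by
  have hle := Nat.unpair_left_le a
  unfold shiftedSq
  rcases z with k | k
  · have : a.unpair.1 = 2 * k := hz.symm
    rw [if_pos (by omega), this]
    push_cast
    simp
  · have h : a.unpair.1 = 2 * k + 1 := hz.symm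
    have : a ≤ a * a := Nat.le_mul_self a
    rw [if_neg (by omega), h]
    have e : (2 * k + 1) / 2 = k := by omega
    rw [e, Nat.cast_sub (by omega), Int.negSucc_eq]
    push_cast
    ring

theorem shiftedSq_mono : Monotone shiftedSq := by
  refine monotone_nat_of_le_succ fun a => ?_
  have h₁ := Nat.unpair_left_le a
  have h₂ := Nat.unpair_left_le (a + 1)
  have h₃ : (a + 1) * (a + 1) = a * a + 2 * a + 1 := by ring
  unfold shiftedSq
  rw [h₃]
  split_ifs <;> omega

theorem pmax_range_comp {h u : ℕ → ℕ} {a : ℕ} (hh : Monotone h)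
    (ha : IsGreatest (Set.range u) a) : pmax (Set.range fun t => h (u t)) = Part.some (h a) := by
  have : IsGreatest (Set.range fun t => h (u t)) (h a) := by
    obtain ⟨⟨t, rfl⟩, hmax⟩ := ha
    exact ⟨⟨t, rfl⟩, by rintro _ ⟨s, rfl⟩; exact hh (hmax ⟨s, rfl⟩)⟩
  exact Part.eq_some_iff.2 ⟨⟨this.nonempty, this.bddAbove⟩, this.csSup_eq⟩

theorem recInP_of_guess {A : Set ℕ} (e : ℕ) {h : ℕ → ℕ} (hh : Primrec h) :
    RecInP A fun q : List Bool × ℕ =>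
      Part.some (h (guess (JumpStage A) e (Encodable.encode q.1) q.2)) := by
  have hF : Primrec₂ fun b z : ℕ => h (guess (JumpApprox (Denumerable.ofNat (List ℕ) b)) e
      z.unpair.1 z.unpair.2) :=
    hh.comp ((primrec_guess e).comp (((Primrec.ofNat _).comp Primrec.fst).pair
      (Primrec.unpair.comp Primrec.snd)))
  obtain ⟨c, hc⟩ := HasOCode.map₂_primrec hF
    ((hasOCode_bits A).comp_primrec (Primrec.snd.comp Primrec.unpair))
    (HasOCode.of_primrec Primrec.id)
  refine ⟨c, fun ⟨p, t⟩ => ?_⟩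
  rw [hc]
  simp [guess_congr (J := JumpApprox (bits A t)) (J' := JumpStage A) fun m s => jumpApprox_bits]

theorem RecInP.exists_pmax_sub_pmax {A : Set ℕ} {G : List Bool →. ℤ} (h : RecInP (jump A) G) :
    ∃ f g : List Bool × ℕ → ℕ,
      RecInP A (fun q => Part.some (f q)) ∧ RecInP A (fun q => Part.some (g q)) ∧
      ∀ p : List Bool,
        G p = psub (pmax (Set.range fun t => f (p, t)))
                   (pmax (Set.range fun t => g (p, t))) := by
  obtain ⟨c, hc⟩ := h
  have hsq : Primrec fun a : ℕ => a * a := Primrec.nat_mul.comp Primrec.id Primrec.id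
  refine ⟨_, _, recInP_of_guess (encOCode c) primrec_shiftedSq,
    recInP_of_guess (encOCode c) hsq, fun p => ?_⟩
  rw [← exists_jumpStage] at hc
  set u := guess (JumpStage A) (encOCode c) (Encodable.encode p) with hu
  by_cases hb : BddAbove (Set.range u)
  · obtain ⟨a, ha⟩ : ∃ a, IsGreatest (Set.range u) a :=
      ⟨_, Nat.sSup_mem (Set.range_nonempty u) hb, fun _ => le_csSup hb⟩
    have hm := mem_evalo_of_forall_plausible
      (plausible_of_isGreatest_guess JumpStage.mono ha)
    rw [hc] at hm
    obtain ⟨z, hz, hza⟩ := (Part.mem_map_iff _).1 hm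
    rw [Part.eq_some_iff.2 hz, pmax_range_comp shiftedSq_mono ha,
      pmax_range_comp (h := fun a => a * a) (fun _ _ h => Nat.mul_le_mul h h) ha]
    simp [psub, ← shiftedSq_sub a hza]
  · have hG : G p = Part.none := by
      refine Part.eq_none_iff.2 fun z hz => hb ?_
      have hm : Encodable.encode z ∈ (G p).map Encodable.encode := Part.mem_map _ hz
      rw [← hc] at hm
      obtain ⟨a, ha⟩ := exists_forall_plausible JumpStage.mono hm
      exact ⟨a, by rintro _ ⟨t, rfl⟩; exact guess_le_of_plausible (ha t)⟩
    rw [hG, eq_comm, Part.eq_none_iff]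
    intro z hz
    obtain ⟨x, -, hz⟩ := Part.mem_bind_iff.1 hz
    obtain ⟨y, hy, -⟩ := Part.mem_bind_iff.1 hz
    obtain ⟨⟨-, b, hbb⟩, -⟩ := hy
    exact hb ⟨b, by rintro _ ⟨t, rfl⟩; exact (Nat.le_mul_self _).trans (hbb ⟨t, rfl⟩)⟩

theorem stmt8 (A : Set ℕ) (G : List Bool →. ℤ) :
    RecInP (jump A) G ↔
    ∃ f g : List Bool × ℕ → ℕ,
      RecInP A (fun q => Part.some (f q)) ∧ RecInP A (fun q => Part.some (g q)) ∧
      ∀ p : List Bool,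
        G p = psub (pmax (Set.range fun t => f (p, t)))
                   (pmax (Set.range fun t => g (p, t))) := by
  exact ⟨RecInP.exists_pmax_sub_pmax, fun ⟨_, _, hf, hg, hG⟩ => .of_pmax_sub_pmax hf hg hG⟩
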